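/- In ℂ[x,y], let s = √59 (the positive real square root of 59), and define f2 = -y^2 - (1/5)xys - (13/5)xy + (1/5)ys + (13/5)y + 3x^2 + (1/5)xs - (12/5)x - (1/5)s + 2/5, g2 = -(1/219010)(-155 + 6s)(1810y^2 + 173s + 1724 + 1724xy - 5084y + 1506x + 173xys - 233ys - 1680x^2 - 30x^2 s - 83xs), and h2 = (1/1876463765)(-26177 + 2292s)(2996295x^2 - 256330y^2 + 24928xys + 14372ys - 371968xs + 306120x^2 s + 956794 + 183424xy + 77308s + 346616y - 3822204x). Let g = f2^3 + g2^2 * h2. Then g is irreducible in ℂ[x,y], and there do not exist polynomials p, q ∈ ℂ[x,y] with total degree of p at most 2 and total degree of q at most 3 such that g = p^3 + q^2. -/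

import Mathlib

open MvPolynomial

noncomputable section

def x : MvPolynomial (Fin 2) ℂ := X 0
def y : MvPolynomial (Fin 2) ℂ := X 1
def c (q : ℚ) : MvPolynomial (Fin 2) ℂ := C (q : ℂ)

/-- `s = √59`, as a constant polynomial. -/
def s : MvPolynomial (Fin 2) ℂ := C ((Real.sqrt 59 : ℝ) : ℂ)

def f2 : MvPolynomial (Fin 2) ℂ :=
  - y ^ 2 - c (1/5) * x * y * s - c (13/5) * x * y + c (1/5) * y * s + c (13/5) * y
    + 3 * x ^ 2 + c (1/5) * x * s - c (12/5) * x - c (1/5) * s + c (2/5)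

def g2 : MvPolynomial (Fin 2) ℂ :=
  - (c (1/219010) * (-155 + 6 * s) *
    (1810 * y ^ 2 + 173 * s + 1724 + 1724 * x * y - 5084 * y + 1506 * x
      + 173 * x * y * s - 233 * y * s - 1680 * x ^ 2 - 30 * x ^ 2 * s - 83 * x * s))

def h2 : MvPolynomial (Fin 2) ℂ :=
  c (1/1876463765) * (-26177 + 2292 * s) *
    (2996295 * x ^ 2 - 256330 * y ^ 2 + 24928 * x * y * s + 14372 * y * s
      - 371968 * x * s + 306120 * x ^ 2 * s + 956794 + 183424 * x * y
      + 77308 * s + 346616 * y - 3822204 * x)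

/-- The sextic of semi-torus type with configuration `[A_8 + 3A_2]`. -/
def g : MvPolynomial (Fin 2) ℂ := f2 ^ 3 + g2 ^ 2 * h2

set_option linter.all false

def Gx (s u t : ℂ) : ℂ :=
  t^4+88/5*t^5-4412/25*t^6+u^2-909/5*u^3-83841/25*u^4-2328209/125*u^5-27196414/625*u^6-4/5*s*
      t^5-633/50*s*t^6-271/10*s*u^3-9322/25*s*u^4-211831/250*s*u^5+1078037/625*s*u^6-131/10*t*
      u^2-63957/50*t*u^3+1276971/250*t*u^4+89707029/1250*t*u^5+2*t^2*u+9297/20*t^2*u^2+70332/5*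
      t^2*u^3+168850347/2500*t^2*u^4+9/2*t^3*u+1229959/250*t^3*u^2+2625473/250*t^3*u^3-686*t^4*
      u-14102959/1250*t^4*u^2-1380117/250*t^5*u-87/10*s*t*u^2-11647/25*s*t*u^3-1023543/250*s*t*
      u^4-8876666/625*s*t*u^5-1947/40*s*t^2*u^2-26349/20*s*t^2*u^3-37515527/5000*s*t^2*u^4-19/2
      *s*t^3*u-2511/125*s*t^3*u^2+15258/125*s*t^3*u^3-311/2*s*t^4*u-1346331/2500*s*t^4*u^2-
      131139/250*s*t^5*u

theorem coeffs7 (c0 c1 c2 c3 c4 c5 c6 : ℂ)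
    (h : ∀ t : ℂ, c0 + c1*t + c2*t^2 + c3*t^3 + c4*t^4 + c5*t^5 + c6*t^6 = 0) :
    c0 = 0 ∧ c1 = 0 ∧ c2 = 0 ∧ c3 = 0 ∧ c4 = 0 ∧ c5 = 0 ∧ c6 = 0 := by
  have hP : (Polynomial.C c0 + Polynomial.C c1 * Polynomial.X + Polynomial.C c2 * Polynomial.X ^ 2
      + Polynomial.C c3 * Polynomial.X ^ 3 + Polynomial.C c4 * Polynomial.X ^ 4
      + Polynomial.C c5 * Polynomial.X ^ 5 + Polynomial.C c6 * Polynomial.X ^ 6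
      : Polynomial ℂ) = 0 := by
    apply Polynomial.funext
    intro r
    simpa using h r
  have k := fun n => congrArg (fun P : Polynomial ℂ => P.coeff n) hP
  have k0 := k 0
  have k1 := k 1
  have k2 := k 2
  have k3 := k 3
  have k4 := k 4
  have k5 := k 5
  have k6 := k 6
  simp [Polynomial.coeff_X, Polynomial.coeff_C, Polynomial.coeff_X_pow] at k0 k1 k2 k3 k4 k5 k6
  exact ⟨k0, k1, k2, k3, k4, k5, k6⟩

theorem coeffs28 (c00 c01 c02 c03 c04 c05 c06 c10 c11 c12 c13 c14 c15 c20 c21 c22 c23 c24 c30 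
      c31 c32 c33 c40 c41 c42 c50 c51 c60 : ℂ)
    (h : ∀ u t : ℂ, c00 + c01*t^1 + c02*t^2 + c03*t^3 + c04*t^4 + c05*t^5 + c06*t^6 + c10*u^1 + 
      c11*u^1*t^1 + c12*u^1*t^2 + c13*u^1*t^3 + c14*u^1*t^4 + c15*u^1*t^5 + c20*u^2 + c21*u^2*
      t^1 + c22*u^2*t^2 + c23*u^2*t^3 + c24*u^2*t^4 + c30*u^3 + c31*u^3*t^1 + c32*u^3*t^2 + c33
      *u^3*t^3 + c40*u^4 + c41*u^4*t^1 + c42*u^4*t^2 + c50*u^5 + c51*u^5*t^1 + c60*u^6 = 0) :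
    c00 = 0 ∧ c01 = 0 ∧ c02 = 0 ∧ c03 = 0 ∧ c04 = 0 ∧ c05 = 0 ∧ c06 = 0 ∧ c10 = 0 ∧ c11 = 0 ∧ 
      c12 = 0 ∧ c13 = 0 ∧ c14 = 0 ∧ c15 = 0 ∧ c20 = 0 ∧ c21 = 0 ∧ c22 = 0 ∧ c23 = 0 ∧ c24 = 0 ∧ 
      c30 = 0 ∧ c31 = 0 ∧ c32 = 0 ∧ c33 = 0 ∧ c40 = 0 ∧ c41 = 0 ∧ c42 = 0 ∧ c50 = 0 ∧ c51 = 0 ∧ 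
      c60 = 0 := by
  have k : ∀ t : ℂ, _ := fun t => coeffs7 (c00 + c01*t^1 + c02*t^2 + c03*t^3 + c04*t^4 + c05*
      t^5 + c06*t^6) (c10 + c11*t^1 + c12*t^2 + c13*t^3 + c14*t^4 + c15*t^5) (c20 + c21*t^1 + 
      c22*t^2 + c23*t^3 + c24*t^4) (c30 + c31*t^1 + c32*t^2 + c33*t^3) (c40 + c41*t^1 + c42*
      t^2) (c50 + c51*t^1) (c60) (fun u => by linear_combination h u t)
  have k0 := coeffs7 c00 c01 c02 c03 c04 c05 c06 (fun t => by linear_combination (k t).1)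
  have k1 := coeffs7 c10 c11 c12 c13 c14 c15 0 (fun t => by linear_combination (k t).2.1)
  have k2 := coeffs7 c20 c21 c22 c23 c24 0 0 (fun t => by linear_combination (k t).2.2.1)
  have k3 := coeffs7 c30 c31 c32 c33 0 0 0 (fun t => by linear_combination (k t).2.2.2.1)
  have k4 := coeffs7 c40 c41 c42 0 0 0 0 (fun t => by linear_combination (k t).2.2.2.2.1)
  have k5 := coeffs7 c50 c51 0 0 0 0 0 (fun t => by linear_combination (k t).2.2.2.2.2.1)
  have k6 := coeffs7 c60 0 0 0 0 0 0 (fun t => by linear_combination (k t).2.2.2.2.2.2)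
  simp only [and_true] at k0 k1 k2 k3 k4 k5 k6
  refine ⟨?_, ?_, ?_, ?_, ?_, ?_, ?_, ?_, ?_, ?_, ?_, ?_, ?_, ?_, ?_, ?_, ?_, ?_, ?_, ?_, ?_, 
      ?_, ?_, ?_, ?_, ?_, ?_, ?_⟩ <;> tauto

theorem no_conic (s : ℂ) (hs : s^2 - 59 = 0) (a01 a02 a10 a11 a20 b00 b01 b02 b03 b04 b10 b11 
      b12 b13 b20 b21 b22 b30 b31 b40 : ℂ)
    (h : ∀ u t : ℂ, Gx s u t = (1 + a01*t^1 + a02*t^2 + a10*u^1 + a11*u^1*t^1 + a20*u^2) * (b00 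
      + b01*t^1 + b02*t^2 + b03*t^3 + b04*t^4 + b10*u^1 + b11*u^1*t^1 + b12*u^1*t^2 + b13*u^1*
      t^3 + b20*u^2 + b21*u^2*t^1 + b22*u^2*t^2 + b30*u^3 + b31*u^3*t^1 + b40*u^4)) : False := 
      by
  obtain ⟨e00, e01, e02, e03, e04, e05, e06, e10, e11, e12, e13, e14, e15, e20, e21, e22, e23, 
      e24, e30, e31, e32, e33, e40, e41, e42, e50, e51, e60⟩ := coeffs28
    (-b00)
    (-b01-a01*b00)
    (-b02-a01*b01-a02*b00)
    (-b03-a01*b02-a02*b01)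
    (1-b04-a01*b03-a02*b02)
    (88/5-4/5*s-a01*b04-a02*b03)
    (-4412/25-633/50*s-a02*b04)
    (-b10-a10*b00)
    (-b11-a01*b10-a10*b01-a11*b00)
    (2-b12-a01*b11-a02*b10-a10*b02-a11*b01)
    (9/2-b13-19/2*s-a01*b12-a02*b11-a10*b03-a11*b02)
    (-686-311/2*s-a01*b13-a02*b12-a10*b04-a11*b03)
    (-1380117/250-131139/250*s-a02*b13-a11*b04)
    (1-b20-a10*b10-a20*b00)
    (-131/10-b21-87/10*s-a01*b20-a10*b11-a11*b10-a20*b01)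
    (9297/20-b22-1947/40*s-a01*b21-a02*b20-a10*b12-a11*b11-a20*b02)
    (1229959/250-2511/125*s-a01*b22-a02*b21-a10*b13-a11*b12-a20*b03)
    (-14102959/1250-1346331/2500*s-a02*b22-a11*b13-a20*b04)
    (-909/5-b30-271/10*s-a10*b20-a20*b10)
    (-63957/50-b31-11647/25*s-a01*b30-a10*b21-a11*b20-a20*b11)
    (70332/5-26349/20*s-a01*b31-a02*b30-a10*b22-a11*b21-a20*b12)
    (2625473/250+15258/125*s-a02*b31-a11*b22-a20*b13)
    (-83841/25-b40-9322/25*s-a10*b30-a20*b20)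
    (1276971/250-1023543/250*s-a01*b40-a10*b31-a11*b30-a20*b21)
    (168850347/2500-37515527/5000*s-a02*b40-a11*b31-a20*b22)
    (-2328209/125-211831/250*s-a10*b40-a20*b30)
    (89707029/1250-8876666/625*s-a11*b40-a20*b31)
    (-27196414/625+1078037/625*s-a20*b40)
    (fun u t => by unfold Gx at h; linear_combination h u t)
  have hv : b00 = 0 := by
    linear_combination (-1)*e00
  subst hv
  have hv : b01 = 0 := by
    linear_combination (-1)*e01
  subst hv
  have hv : b02 = 0 := by
    linear_combination (-1)*e02
  subst hv
  have hv : b03 = 0 := by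
    linear_combination (-1)*e03
  subst hv
  have hv : b04 = 1 := by
    linear_combination (-1)*e04
  subst hv
  have hv : a01 = 88/5-4/5*s := by
    linear_combination (-1)*e05
  subst hv
  have hv : a02 = -4412/25-633/50*s := by
    linear_combination (-1)*e06
  subst hv
  have hv : b10 = 0 := by
    linear_combination (-1)*e10
  subst hv
  have hv : b11 = 0 := by
    linear_combination (-1)*e11
  subst hv
  have hv : b12 = 2 := by
    linear_combination (-1)*e12
  subst hv
  have hv : b13 = -307/10-79/10*s := by
    linear_combination (-1)*e13
  subst hv
  have hv : a10 = -828/5-157/10*s := by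
    linear_combination (-1)*e14 + (-158/25)*hs
  subst hv
  have hv : a11 = -1683923/100-230741/100*s := by
    linear_combination (-1)*e15 + (-50007/500)*hs
  subst hv
  have hv : b20 = 1 := by
    linear_combination (-1)*e20
  subst hv
  have hv : b21 = -307/10-79/10*s := by
    linear_combination (-1)*e21
  subst hv
  have hv : b22 = 113997/100+21973/200*s := by
    linear_combination (-1)*e22 + (-158/25)*hs
  subst hv
  have hv : a20 = -2640972121/2000-170584941/1000*s := by
    linear_combination (-1)*e24 + (-168376481/10000)*hs
  subst hv
  have hv : b30 = -81/5-57/5*s := by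
    linear_combination (-1)*e30
  subst hv
  have hv : b31 = 72636/25+11949/50*s := by
    linear_combination (-1)*e31 + (-2663/20)*hs
  subst hv
  have hv : (1:ℂ) = 0 := by
    linear_combination (41661035536/966143128962649-5375281312/966143128962649*s)*e32 + 
      (198566725511288161/120767891120331125-11057490179049954/120767891120331125*s)*hs
  exact one_ne_zero hv

theorem no_line (s : ℂ) (hs : s^2 - 59 = 0) (r m b00 b01 b02 b03 b04 b05 b10 b11 b12 b13 b14 
      b20 b21 b22 b23 b30 b31 b32 b40 b41 b50 : ℂ)
    (h : ∀ u t : ℂ, Gx s u t = (1 + r*t + m*u) * (b00 + b01*t^1 + b02*t^2 + b03*t^3 + b04*t^4 + 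
      b05*t^5 + b10*u^1 + b11*u^1*t^1 + b12*u^1*t^2 + b13*u^1*t^3 + b14*u^1*t^4 + b20*u^2 + b21
      *u^2*t^1 + b22*u^2*t^2 + b23*u^2*t^3 + b30*u^3 + b31*u^3*t^1 + b32*u^3*t^2 + b40*u^4 + 
      b41*u^4*t^1 + b50*u^5)) : False := by
  obtain ⟨e00, e01, e02, e03, e04, e05, e06, e10, e11, e12, e13, e14, e15, e20, e21, e22, e23, 
      e24, e30, e31, e32, e33, e40, e41, e42, e50, e51, e60⟩ := coeffs28
    (-b00)
    (-b01-b00*r)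
    (-b02-b01*r)
    (-b03-b02*r)
    (1-b04-b03*r)
    (88/5-b05-4/5*s-b04*r)
    (-4412/25-633/50*s-b05*r)
    (-b10-b00*m)
    (-b11-b01*m-b10*r)
    (2-b12-b02*m-b11*r)
    (9/2-b13-19/2*s-b03*m-b12*r)
    (-686-b14-311/2*s-b04*m-b13*r)
    (-1380117/250-131139/250*s-b05*m-b14*r)
    (1-b20-b10*m)
    (-131/10-b21-87/10*s-b11*m-b20*r)
    (9297/20-b22-1947/40*s-b12*m-b21*r)
    (1229959/250-b23-2511/125*s-b13*m-b22*r)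
    (-14102959/1250-1346331/2500*s-b14*m-b23*r)
    (-909/5-b30-271/10*s-b20*m)
    (-63957/50-b31-11647/25*s-b21*m-b30*r)
    (70332/5-b32-26349/20*s-b22*m-b31*r)
    (2625473/250+15258/125*s-b23*m-b32*r)
    (-83841/25-b40-9322/25*s-b30*m)
    (1276971/250-b41-1023543/250*s-b31*m-b40*r)
    (168850347/2500-37515527/5000*s-b32*m-b41*r)
    (-2328209/125-b50-211831/250*s-b40*m)
    (89707029/1250-8876666/625*s-b41*m-b50*r)
    (-27196414/625+1078037/625*s-b50*m)
    (fun u t => by unfold Gx at h; linear_combination h u t)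
  have hv : b00 = 0 := by
    linear_combination (-1)*e00
  subst hv
  have hv : b01 = 0 := by
    linear_combination (-1)*e01
  subst hv
  have hv : b02 = 0 := by
    linear_combination (-1)*e02
  subst hv
  have hv : b03 = 0 := by
    linear_combination (-1)*e03
  subst hv
  have hv : b04 = 1 := by
    linear_combination (-1)*e04
  subst hv
  have hv : b05 = 88/5-r-4/5*s := by
    linear_combination (-1)*e05
  subst hv
  have hv : b10 = 0 := by
    linear_combination (-1)*e10
  subst hv
  have hv : b11 = 0 := by
    linear_combination (-1)*e11
  subst hv
  have hv : b12 = 2 := by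
    linear_combination (-1)*e12
  subst hv
  have hv : b13 = 9/2-2*r-19/2*s := by
    linear_combination (-1)*e13
  subst hv
  have hv : b14 = -686-m-9/2*r+2*r^2-311/2*s+19/2*r*s := by
    linear_combination (-1)*e14
  subst hv
  have hv : b20 = 1 := by
    linear_combination (-1)*e20
  subst hv
  have hv : b21 = -131/10-r-87/10*s := by
    linear_combination (-1)*e21
  subst hv
  have hv : b22 = 9297/20-2*m+131/10*r+r^2-1947/40*s+87/10*r*s := by
    linear_combination (-1)*e22
  subst hv
  have hv : b23 = 1229959/250-9/2*m-9297/20*r-131/10*r^2-r^3-2511/125*s+4*m*r+19/2*m*s+1947/40*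
      r*s-87/10*r^2*s := by
    linear_combination (-1)*e23
  subst hv
  have hr : -4412/25-88/5*r+r^2-633/50*s+4/5*r*s = 0 := by
    linear_combination (1)*e06
  have hv : m = -1002551/4610+46545/1844*r-279939/9220*s+6833/1844*r*s := by
    linear_combination (-52672/3067955+13168/6749501*r+7740/6749501*s-562/33747505*s^2-
      281/6749501*r*s)*e15 + (-4147547/13499002-26336/6749501*m+56527/13499002*r+26336/6749501*
      r^2-890415/6749501*s+562/6749501*m*s+221761/13499002*r*s-562/6749501*r^2*s)*hr + (-
      9791363829/8436876250-26383/168737525*m+421107647/3374750500*r+1095599/337475050*r^2-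
      24447/67495010*r^3-36850059/4218438125*s+2248/168737525*m*s+87391/33747505*r*s-
      5339/33747505*r^2*s)*hs
  subst hv
  have hv : (1:ℂ) = 0 := by
    linear_combination (-13096862755536/219495496199791009+1688896021312/219495496199791009*s)*
      e24 + (375773173696103280/101187423748103655149-153190529803712/219495496199791009*r+
      13096862755536/219495496199791009*r^2-79080183822847140/101187423748103655149*s+
      16210908684704/219495496199791009*r*s-1688896021312/219495496199791009*r^2*s)*hr + 
      (2518914518889153022669153/29154626467422365639805625+
      8898549777213879791308/5830925293484473127961125*r-
      2998436617996966561783/1166185058696894625592225*r^2+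
      55797746752105856/505937118740518275745*r^3+
      3099368896813131814428/106016823517899511417475*s-
      333110184922314139504/46647402347875785023689*r*s+
      20341813022735183868/46647402347875785023689*r^2*s)*hs
  exact one_ne_zero hv

theorem no_outer (s : ℂ) (hs : s^2 - 59 = 0) (w p01 p02 p10 p11 p20 r01 r02 r03 r10 r11 r12 r20 
      r21 r30 : ℂ)
    (h : ∀ u t : ℂ, Gx s u t = w * ((1 + r01*t^1 + r02*t^2 + r03*t^3 + r10*u^1 + r11*u^1*t^1 + 
      r12*u^1*t^2 + r20*u^2 + r21*u^2*t^1 + r30*u^3)^2 - (1 + p01*t^1 + p02*t^2 + p10*u^1 + p11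
      *u^1*t^1 + p20*u^2)^3)) : False := by
  obtain ⟨k, rfl⟩ : ∃ k, p01 = 2*k := ⟨p01/2, by ring⟩
  obtain ⟨D, rfl⟩ : ∃ D, p02 = k^2 + D := ⟨p02 - k^2, by ring⟩
  obtain ⟨e00, e01, e02, e03, e04, e05, e06, e10, e11, e12, e13, e14, e15, e20, e21, e22, e23, 
      e24, e30, e31, e32, e33, e40, e41, e42, e50, e51, e60⟩ := coeffs28
    (0)
    (6*k*w-2*r01*w)
    (3*D*w+15*k^2*w-r01^2*w-2*r02*w)
    (20*k^3*w-2*r03*w+12*D*k*w-2*r01*r02*w)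
    (1+3*D^2*w+15*k^4*w-r02^2*w+18*D*k^2*w-2*r01*r03*w)
    (88/5-4/5*s+6*k^5*w+12*D*k^3*w+6*D^2*k*w-2*r02*r03*w)
    (-4412/25-633/50*s+D^3*w+k^6*w-r03^2*w+3*D*k^4*w+3*D^2*k^2*w)
    (3*p10*w-2*r10*w)
    (3*p11*w-2*r11*w+12*k*p10*w-2*r01*r10*w)
    (2-2*r12*w+6*D*p10*w+12*k*p11*w+18*k^2*p10*w-2*r01*r11*w-2*r02*r10*w)
    (9/2-19/2*s+6*D*p11*w+18*k^2*p11*w+12*k^3*p10*w-2*r01*r12*w-2*r02*r11*w-2*r03*r10*w+12*D*k*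
      p10*w)
    (-686-311/2*s+3*D^2*p10*w+12*k^3*p11*w+3*k^4*p10*w-2*r02*r12*w-2*r03*r11*w+12*D*k*p11*w+6*D
      *k^2*p10*w)
    (-1380117/250-131139/250*s+3*D^2*p11*w+3*k^4*p11*w-2*r03*r12*w+6*D*k^2*p11*w)
    (1+3*p10^2*w+3*p20*w-r10^2*w-2*r20*w)
    (-131/10-87/10*s-2*r21*w+6*k*p10^2*w+12*k*p20*w+6*p10*p11*w-2*r01*r20*w-2*r10*r11*w)
    (9297/20-1947/40*s+3*p11^2*w-r11^2*w+3*D*p10^2*w+6*D*p20*w+3*k^2*p10^2*w+18*k^2*p20*w-2*r01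
      *r21*w-2*r02*r20*w-2*r10*r12*w+12*k*p10*p11*w)
    (1229959/250-2511/125*s+6*k*p11^2*w+12*k^3*p20*w-2*r02*r21*w-2*r03*r20*w-2*r11*r12*w+12*D*k
      *p20*w+6*D*p10*p11*w+6*k^2*p10*p11*w)
    (-14102959/1250-1346331/2500*s-r12^2*w+3*D*p11^2*w+3*D^2*p20*w+3*k^2*p11^2*w+3*k^4*p20*w-2*
      r03*r21*w+6*D*k^2*p20*w)
    (-909/5-271/10*s+p10^3*w-2*r30*w+6*p10*p20*w-2*r10*r20*w)
    (-63957/50-11647/25*s+3*p10^2*p11*w+6*p11*p20*w-2*r01*r30*w-2*r10*r21*w-2*r11*r20*w+12*k*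
      p10*p20*w)
    (70332/5-26349/20*s+3*p10*p11^2*w-2*r02*r30*w-2*r11*r21*w-2*r12*r20*w+6*D*p10*p20*w+12*k*
      p11*p20*w+6*k^2*p10*p20*w)
    (2625473/250+15258/125*s+p11^3*w-2*r03*r30*w-2*r12*r21*w+6*D*p11*p20*w+6*k^2*p11*p20*w)
    (-83841/25-9322/25*s+3*p20^2*w-r20^2*w+3*p10^2*p20*w-2*r10*r30*w)
    (1276971/250-1023543/250*s+6*k*p20^2*w-2*r11*r30*w-2*r20*r21*w+6*p10*p11*p20*w)
    (168850347/2500-37515527/5000*s-r21^2*w+3*D*p20^2*w+3*k^2*p20^2*w+3*p11^2*p20*w-2*r12*r30*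
      w)
    (-2328209/125-211831/250*s+3*p10*p20^2*w-2*r20*r30*w)
    (89707029/1250-8876666/625*s+3*p11*p20^2*w-2*r21*r30*w)
    (-27196414/625+1078037/625*s+p20^3*w-r30^2*w)
    (fun u t => by unfold Gx at h; linear_combination h u t)
  have hw : w ≠ 0 := by
    rintro rfl
    have hv : (1:ℂ) = 0 := by linear_combination e04
    exact one_ne_zero hv
  have hv : r01 = 3*k := by
    apply mul_left_cancel₀ hw
    linear_combination (-1/2)*e01
  subst hv
  have hv : r02 = 3/2*D+3*k^2 := by
    apply mul_left_cancel₀ hw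
    linear_combination (-1/2)*e02
  subst hv
  have hv : r03 = k^3+3/2*D*k := by
    apply mul_left_cancel₀ hw
    linear_combination (-1/2)*e03
  subst hv
  have hv : k = 44/5-2/5*s := by
    linear_combination (k)*e04 + (-1/2)*e05
  subst hv
  have hv : D = -4938/25-843/200*s := by
    linear_combination (-3/4)*e06 + (1452/25+D-132/25*s+3/25*s^2)*e04 + (-3/25)*hs
  subst hv
  have hv : w = -15194020096/410001873741009+1894506496/1230005621223027*s := by
    linear_combination (15194020096/410001873741009-1894506496/1230005621223027*s)*e04 + 
      (40706762198053/28472352343125625*w+584344247776/28472352343125625*s*w)*hs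
  subst hv
  have hv : r10 = 3/2*p10 := by
    linear_combination (4807482921/320000+6244101/10000*s)*e10 + (-
      82149235459584/28472352343125625*p10+54766156973056/28472352343125625*r10)*hs
  subst hv
  have hv : r11 = 66/5*p10+3/2*p11-3/5*p10*s := by
    linear_combination (4807482921/320000+6244101/10000*s)*e11 + (-
      328596941838336/12941978337784375*p10-82149235459584/28472352343125625*p11+
      54766156973056/28472352343125625*r11+164298470919168/142361761715628125*p10*s)*hs
  subst hv
  have hv : r12 = -4807482921/160000-7407/50*p10+66/5*p11-6244101/5000*s-2529/800*p10*s-3/5*p11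
      *s := by
    linear_combination (4807482921/320000+6244101/10000*s)*e12 + 
      (202826462349712896/711808808578140625*p10-328596941838336/12941978337784375*p11+
      54766156973056/28472352343125625*r12+4328237843276832/711808808578140625*p10*s+
      164298470919168/142361761715628125*p11*s)*hs
  subst hv
  have hv : p10 = -27478557/27200+11/85*p11-3730989/27200*s+1/170*p11*s := by
    linear_combination (-36753/2720-1161/1360*s)*e13 + (-
      165056349658843311093/35202181078773500000+13405114600751/2588395667556875*p10-
      31087780377623/96805997966627125*p11+17312951373107328/711808808578140625*s-
      47687631184288512/12100749745828390625*s^2-26765547050158/484029989833135625*p10*s-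
      1609546077504/484029989833135625*p10*s^2-804773038752/96805997966627125*p11*s)*hs
  subst hv
  have hv : p11 = 4089931/800+573677/800*s := by
    linear_combination (-44/5+2/5*s)*e14 + (-2608081413717352594553/10353582670227500000+
      46957968181829/5882717426265625*p11+294708590574444340719/22777881874500500000*s-
      243342108896289591007/1936119959332542500000*s^2-69451253838207229/12100749745828390625*
      s^3+10344872885720192/60503748729141953125*s^4-81785785659008/194129675066765625*p11*s+
      105401474921947/12100749745828390625*p11*s^2+1296551705248/12100749745828390625*p11*s^3-
      266178162688/36302249237485171875*p11*s^4)*hs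
  subst hv
  have hv : (1:ℂ) = 0 := by
    linear_combination (10350988/45552147993-1469396/45552147993*s)*e15 + (-
      96257488226071760238034254469/810610504776811741369137890625+
      566388395431450555932642682/8268227148723479761965206484375*s+
      524387802162757747536307633/1670348918934036315548526562500*s^2-
      840132596227136558254045853/66145817189787838095721651875000*s^3+
      47172717530630695136937149/330729085948939190478608259375000*s^4+
      21771084818927079422284/2756075716241159920655068828125*s^5-
      3505893673193649796864/41341135743617398809826032421875*s^6)*hs
  exact one_ne_zero hv

theorem no_inner (s : ℂ) (hs : s^2 - 59 = 0) (c p10 p11 p20 r03 r10 r11 r12 r20 r21 r30 : ℂ)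
    (h : ∀ u t : ℂ, Gx s u t = c*(t^2 + p10*u^1 + p11*u^1*t^1 + p20*u^2)^3 + (t^2 + r03*t^3 + 
      r10*u^1 + r11*u^1*t^1 + r12*u^1*t^2 + r20*u^2 + r21*u^2*t^1 + r30*u^3)^2) : False := by
  obtain ⟨e00, e01, e02, e03, e04, e05, e06, e10, e11, e12, e13, e14, e15, e20, e21, e22, e23, 
      e24, e30, e31, e32, e33, e40, e41, e42, e50, e51, e60⟩ := coeffs28
    (0)
    (0)
    (0)
    (0)
    (0)
    (88/5-2*r03-4/5*s)
    (-4412/25-c-r03^2-633/50*s)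
    (0)
    (0)
    (2-2*r10)
    (9/2-2*r11-19/2*s-2*r03*r10)
    (-686-2*r12-311/2*s-3*c*p10-2*r03*r11)
    (-1380117/250-131139/250*s-3*c*p11-2*r03*r12)
    (1-r10^2)
    (-131/10-87/10*s-2*r10*r11)
    (9297/20-r11^2-2*r20-1947/40*s-3*c*p10^2-2*r10*r12)
    (1229959/250-2*r21-2511/125*s-2*r03*r20-2*r11*r12-6*c*p10*p11)
    (-14102959/1250-r12^2-1346331/2500*s-3*c*p11^2-3*c*p20-2*r03*r21)
    (-909/5-271/10*s-c*p10^3-2*r10*r20)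
    (-63957/50-11647/25*s-2*r10*r21-2*r11*r20-3*c*p10^2*p11)
    (70332/5-2*r30-26349/20*s-2*r11*r21-2*r12*r20-3*c*p10*p11^2-6*c*p10*p20)
    (2625473/250+15258/125*s-c*p11^3-2*r03*r30-2*r12*r21-6*c*p11*p20)
    (-83841/25-r20^2-9322/25*s-2*r10*r30-3*c*p10^2*p20)
    (1276971/250-1023543/250*s-2*r11*r30-2*r20*r21-6*c*p10*p11*p20)
    (168850347/2500-r21^2-37515527/5000*s-3*c*p20^2-2*r12*r30-3*c*p11^2*p20)
    (-2328209/125-211831/250*s-2*r20*r30-3*c*p10*p20^2)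
    (89707029/1250-8876666/625*s-2*r21*r30-3*c*p11*p20^2)
    (-27196414/625-r30^2+1078037/625*s-c*p20^3)
    (fun u t => by unfold Gx at h; linear_combination h u t)
  have hv : r03 = 44/5-2/5*s := by
    linear_combination (-1/2)*e05
  subst hv
  have hv : c = -6584/25-281/50*s := by
    linear_combination (-1)*e06 + (-4/25)*hs
  subst hv
  have hv : r10 = 1 := by
    linear_combination (-1/2)*e12
  subst hv
  have hv : r11 = -131/20-87/20*s := by
    linear_combination (-1/2)*e13
  subst hv
  have hv : r12 = -19401/50+9876/25*p10-4209/100*s+843/100*p10*s := by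
    linear_combination (-1/2)*e14 + (-87/50)*hs
  subst hv
  have hv : r20 = 2039/50-9876/25*p10+9876/25*p10^2-537/50*s-843/100*p10*s+843/100*p10^2*s := 
      by
    linear_combination (-1/2)*e22 + (-7569/800)*hs
  subst hv
  have hc : (p10 - 1)^3 = 0 := by
    linear_combination (26336/6749501-562/6749501*s)*e30 + (-78961/168737525+236883/168737525*
      p10-236883/168737525*p10^2+78961/168737525*p10^3)*hs
  have hv : p10 = 1 := sub_eq_zero.mp (pow_eq_zero_iff (three_ne_zero) |>.mp hc)
  subst hv
  have hv : p11 = 21961/2305-683/2305*s := by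
    linear_combination (26336/20248503-562/20248503*s)*e15 + (6253911/168737525+78961/168737525
      *p11-57324/76698875*s)*hs
  subst hv
  have hv : r21 = 60938/125-20329/125*s := by
    linear_combination (-1/2)*e23 + (-71783613/461000)*hs
  subst hv
  have hv : p20 = 68195639/2125210-1189181/1062605*s := by
    linear_combination (26336/20248503-562/20248503*s)*e24 + (9068816794229671/5379040132578750
      +78961/168737525*p20-202788336335069/5379040132578750*s+36834437929/896506688763125*s^2)*
      hs
  subst hv
  have hv : r30 = 7155529499/1152500+184284691/2305000*s := by
    linear_combination (-1/2)*e32 + (-292412692833/265651250+393250227/531302500*s)*hs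
  subst hv
  have hv : (1:ℂ) = 0 := by
    linear_combination (-9141812532133/256996380734854123-509258793139/256996380734854123*s)*
      e33 + (-60092036534474000829965221797/157365599560625257169701643750-
      3277631200016049446737722273/157365599560625257169701643750*s+
      2464927066830825863813784/78682799780312628584850821875*s^2-
      45593923630166090771233/157365599560625257169701643750*s^3)*hs
  exact one_ne_zero hv

def Gam (s : ℂ) : Polynomial (Polynomial ℂ) := Polynomial.C (Polynomial.C (1)*Polynomial.X^4 + Polynomial.C (88/5-4/5*s)*Polynomial.X^5 + Polynomial.C (-4412/25-
      633/50*s)*Polynomial.X^6)*Polynomial.X^0 + Polynomial.C (Polynomial.C (2)*Polynomial.X^2 + Polynomial.C (9/2-19/2*s)*Polynomial.X^3 + Polynomial.C (-686-311/2*s)*Polynomial.X^4 + Polynomial.C (-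
      1380117/250-131139/250*s)*Polynomial.X^5)*Polynomial.X^1 + Polynomial.C (Polynomial.C (1)*Polynomial.X^0 + Polynomial.C (-131/10-87/10*s)*Polynomial.X^1 + Polynomial.C (9297/20-
      1947/40*s)*Polynomial.X^2 + Polynomial.C (1229959/250-2511/125*s)*Polynomial.X^3 + Polynomial.C (-14102959/1250-1346331/2500*s)*Polynomial.X^4)*
      Polynomial.X^2 + Polynomial.C (Polynomial.C (-909/5-271/10*s)*Polynomial.X^0 + Polynomial.C (-63957/50-11647/25*s)*Polynomial.X^1 + Polynomial.C (70332/5-26349/20*s)*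
      Polynomial.X^2 + Polynomial.C (2625473/250+15258/125*s)*Polynomial.X^3)*Polynomial.X^3 + Polynomial.C (Polynomial.C (-83841/25-9322/25*s)*Polynomial.X^0 + Polynomial.C 
      (1276971/250-1023543/250*s)*Polynomial.X^1 + Polynomial.C (168850347/2500-37515527/5000*s)*Polynomial.X^2)*Polynomial.X^4 + Polynomial.C (Polynomial.C (-
      2328209/125-211831/250*s)*Polynomial.X^0 + Polynomial.C (89707029/1250-8876666/625*s)*Polynomial.X^1)*Polynomial.X^5 + Polynomial.C (Polynomial.C (-
      27196414/625+1078037/625*s)*Polynomial.X^0)*Polynomial.X^6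

def phW (s : ℂ) : Polynomial ℂ := Polynomial.C (-307/20-79/20*s) + Polynomial.C (-114807/100-23113/200*s)*Polynomial.X

def ph (s : ℂ) : Polynomial ℂ := Polynomial.X^2*(Polynomial.X*phW s - 1)

theorem ph_eval (s t : ℂ) : (ph s).eval t = t^2*(t*((-307/20-79/20*s) + (-114807/100-23113/200*s)*t) - 1) := by
  simp [ph, phW]

theorem Gam_eval (s u t : ℂ) : ((Gam s).eval (Polynomial.C u)).eval t = Gx s u t := by
  simp [Gam, Gx]
  ring

theorem Gam_ph (s : ℂ) (hs : s^2 - 59 = 0) : ∃ E : Polynomial ℂ,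
    (Gam s).eval (ph s) = Polynomial.X^9*E ∧ E.eval 0 ≠ 0 := by
  obtain ⟨W, hW⟩ : ∃ W, W = phW s := ⟨_, rfl⟩
  have hWe : ∀ t, W.eval t = (-307/20-79/20*s) + (-114807/100-23113/200*s)*t := by
    intro t; rw [hW]; simp [phW]
  refine ⟨Polynomial.C (-45676796718/3125-88467502021/50000*s)*Polynomial.X^0*W^0 + Polynomial.C (48861559/625-3459413/2500*s)*Polynomial.X^0*W^1 + Polynomial.C 
      (1094657/125+172194/125*s)*Polynomial.X^0*W^2 + Polynomial.C (-909/5-271/10*s)*Polynomial.X^0*W^3 + Polynomial.C 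
      (422155312011193/160000+107768230836387/320000*s)*Polynomial.X^1*W^0 + Polynomial.C (553707/50+418572/25*s)*Polynomial.X^1
      *W^1 + Polynomial.C (-92004259/1250+735336/625*s)*Polynomial.X^1*W^2 + Polynomial.C (-63957/50-11647/25*s)*Polynomial.X^1*W^3 + Polynomial.C (-
      89707029/1250+8876666/625*s)*Polynomial.X^2*W^0 + Polynomial.C (-227055572/625+16109876/625*s)*Polynomial.X^2*W^1 + Polynomial.C (-
      214593/250-3116403/125*s)*Polynomial.X^2*W^2 + Polynomial.C (687024/25+17407/100*s)*Polynomial.X^2*W^3 + Polynomial.C (-27196414/625+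
      1078037/625*s)*Polynomial.X^3*W^0 + Polynomial.C (89707029/250-8876666/125*s)*Polynomial.X^3*W^1 + Polynomial.C (739371941/1250-
      91363481/2500*s)*Polynomial.X^3*W^2 + Polynomial.C (-2482411/250+2062344/125*s)*Polynomial.X^3*W^3 + Polynomial.C (-83841/25-9322/25*
      s)*Polynomial.X^3*W^4 + Polynomial.C (163178484/625-6468222/625*s)*Polynomial.X^4*W^1 + Polynomial.C (-89707029/125+17753332/125*s)*
      Polynomial.X^4*W^2 + Polynomial.C (-285260797/625+26923977/1250*s)*Polynomial.X^4*W^3 + Polynomial.C (1276971/250-1023543/250*s)*Polynomial.X^4*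
      W^4 + Polynomial.C (-81589242/125+3234111/125*s)*Polynomial.X^5*W^2 + Polynomial.C (89707029/125-17753332/125*s)*Polynomial.X^5*W^3 + 
      Polynomial.C (401671247/2500-16332427/5000*s)*Polynomial.X^5*W^4 + Polynomial.C (108785656/125-4312148/125*s)*Polynomial.X^6*W^3 + Polynomial.C 
      (-89707029/250+8876666/125*s)*Polynomial.X^6*W^4 + Polynomial.C (-2328209/125-211831/250*s)*Polynomial.X^6*W^5 + Polynomial.C (-
      81589242/125+3234111/125*s)*Polynomial.X^7*W^4 + Polynomial.C (89707029/1250-8876666/625*s)*Polynomial.X^7*W^5 + Polynomial.C 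
      (163178484/625-6468222/625*s)*Polynomial.X^8*W^5 + Polynomial.C (-27196414/625+1078037/625*s)*Polynomial.X^9*W^6, ?_, ?_⟩
  · apply Polynomial.funext
    intro t
    simp only [Gam, Polynomial.derivative_add, Polynomial.derivative_mul, Polynomial.derivative_C, Polynomial.derivative_X_pow, Polynomial.eval_add, Polynomial.eval_mul, Polynomial.eval_C, Polynomial.eval_X, Polynomial.eval_pow, ph_eval,
      hWe, Polynomial.eval_zero, Polynomial.eval_natCast, Polynomial.eval_one, Nat.cast_ofNat, Nat.cast_one, Polynomial.eval_ofNat, Nat.cast_zero,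
      Nat.add_one_sub_one, Nat.reduceSub, zero_mul, mul_zero, zero_add, add_zero, pow_zero, pow_one, mul_one, one_mul, Polynomial.derivative_natCast, Polynomial.derivative_one, Polynomial.derivative_X]
    linear_combination (-6241/400*t^6-2834283/4000*t^7-2604377803/40000*t^8-46603130239/50000*t^9+3543890565231/160000*
      t^10-542967/4000*s*t^7-594700071/80000*s*t^8-8640540807/100000*s*t^9+139429010709/320000*
      s*t^10)*hs
  · intro h0
    simp only [Polynomial.eval_add, Polynomial.eval_mul, Polynomial.eval_C, Polynomial.eval_X, Polynomial.eval_pow, hWe] at h0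
    have hv : (1:ℂ) = 0 := by
      linear_combination (-5921044319456/186465623889791257+771378921952/186465623889791257*s)*h0 - (-744930614554075304101/105946377210108668750+2058958295604848238873/2330820298622390712500*s+
      94852350787203066283/582705074655597678125*s^2+3220834087918098959/466164059724478142500*
      s^3)*hs
    exact one_ne_zero hv


theorem dGam_ph (s : ℂ) (hs : s^2 - 59 = 0) : ∃ E : Polynomial ℂ,
    (Polynomial.derivative (Gam s)).eval (ph s) = Polynomial.X^5*E := by
  obtain ⟨W, hW⟩ : ∃ W, W = phW s := ⟨_, rfl⟩
  have hWe : ∀ t, W.eval t = (-307/20-79/20*s) + (-114807/100-23113/200*s)*t := by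
    intro t; rw [hW]; simp [phW]
  refine ⟨Polynomial.C (129520903/1000+21122201/1000*s)*Polynomial.X^0*W^0 + Polynomial.C (4041/2+261/4*s)*Polynomial.X^0*W^1 + Polynomial.C (48861559/625-
      3459413/2500*s)*Polynomial.X^1*W^0 + Polynomial.C (2189314/125+344388/125*s)*Polynomial.X^1*W^1 + Polynomial.C (-2727/5-813/10*s)*Polynomial.X^1
      *W^2 + Polynomial.C (553707/50+418572/25*s)*Polynomial.X^2*W^0 + Polynomial.C (-92004259/625+1470672/625*s)*Polynomial.X^2*W^1 + Polynomial.C (-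
      191871/50-34941/25*s)*Polynomial.X^2*W^2 + Polynomial.C (-227055572/625+16109876/625*s)*Polynomial.X^3*W^0 + Polynomial.C (-
      214593/125-6232806/125*s)*Polynomial.X^3*W^1 + Polynomial.C (2061072/25+52221/100*s)*Polynomial.X^3*W^2 + Polynomial.C (89707029/250-
      8876666/125*s)*Polynomial.X^4*W^0 + Polynomial.C (739371941/625-91363481/1250*s)*Polynomial.X^4*W^1 + Polynomial.C (-7447233/250+
      6187032/125*s)*Polynomial.X^4*W^2 + Polynomial.C (-335364/25-37288/25*s)*Polynomial.X^4*W^3 + Polynomial.C (163178484/625-6468222/625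
      *s)*Polynomial.X^5*W^0 + Polynomial.C (-179414058/125+35506664/125*s)*Polynomial.X^5*W^1 + Polynomial.C (-855782391/625+80771931/1250
      *s)*Polynomial.X^5*W^2 + Polynomial.C (2553942/125-2047086/125*s)*Polynomial.X^5*W^3 + Polynomial.C (-163178484/125+6468222/125*s)*
      Polynomial.X^6*W^1 + Polynomial.C (269121087/125-53259996/125*s)*Polynomial.X^6*W^2 + Polynomial.C (401671247/625-16332427/1250*s)*
      Polynomial.X^6*W^3 + Polynomial.C (326356968/125-12936444/125*s)*Polynomial.X^7*W^2 + Polynomial.C (-179414058/125+35506664/125*s)*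
      Polynomial.X^7*W^3 + Polynomial.C (-2328209/25-211831/50*s)*Polynomial.X^7*W^4 + Polynomial.C (-326356968/125+12936444/125*s)*Polynomial.X^8*W^3 
      + Polynomial.C (89707029/250-8876666/125*s)*Polynomial.X^8*W^4 + Polynomial.C (163178484/125-6468222/125*s)*Polynomial.X^9*W^4 + Polynomial.C (-
      163178484/625+6468222/625*s)*Polynomial.X^10*W^5, ?_⟩
  · apply Polynomial.funext
    intro t
    simp only [Gam, Polynomial.derivative_add, Polynomial.derivative_mul, Polynomial.derivative_C, Polynomial.derivative_X_pow, Polynomial.eval_add, Polynomial.eval_mul, Polynomial.eval_C, Polynomial.eval_X, Polynomial.eval_pow, ph_eval,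
      hWe, Polynomial.eval_zero, Polynomial.eval_natCast, Polynomial.eval_one, Nat.cast_ofNat, Nat.cast_one, Polynomial.eval_ofNat, Nat.cast_zero,
      Nat.add_one_sub_one, Nat.reduceSub, zero_mul, mul_zero, zero_add, add_zero, pow_zero, pow_one, mul_one, one_mul, Polynomial.derivative_natCast, Polynomial.derivative_one, Polynomial.derivative_X]
    linear_combination (6873/100*t^4+2010831/1000*t^5)*hs


theorem ddGam_ph (s : ℂ) : ((Polynomial.derivative (Polynomial.derivative (Gam s))).eval (ph s)).eval 0 ≠ 0 := by
  have : ((Polynomial.derivative (Polynomial.derivative (Gam s))).eval (ph s)).eval 0 = 2 := by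
    simp only [Gam, Polynomial.derivative_add, Polynomial.derivative_mul, Polynomial.derivative_C, Polynomial.derivative_X_pow, Polynomial.derivative_X,
      zero_mul, zero_add, Polynomial.derivative_zero, Nat.reduceSub, pow_one, pow_zero, Polynomial.derivative_one]
    simp [ph_eval]
    try norm_num
  rw [this]
  exact two_ne_zero


theorem prime_split {a b : Polynomial ℂ} {m n : ℕ} (ha : a ≠ 0) (hb : b ≠ 0)
    (h : Polynomial.X ^ (m + n + 1) ∣ a * b) :
    Polynomial.X ^ (m + 1) ∣ a ∨ Polynomial.X ^ (n + 1) ∣ b := by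
  by_contra hcon
  push Not at hcon
  obtain ⟨h1, h2⟩ := hcon
  have key : ∀ p : Polynomial ℂ, p ≠ 0 → ∀ k, Polynomial.X ^ k ∣ p ↔ k ≤ p.natTrailingDegree := by
    intro p hp k
    rw [Polynomial.X_pow_dvd_iff]
    constructor
    · intro hh
      by_contra hlt
      push Not at hlt
      have := hh _ hlt
      exact hp (Polynomial.trailingCoeff_eq_zero.mp this)
    · intro hh d hd
      exact Polynomial.coeff_eq_zero_of_lt_natTrailingDegree (lt_of_lt_of_le hd hh)
  rw [key _ (mul_ne_zero ha hb), Polynomial.natTrailingDegree_mul ha hb] at h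
  rw [key _ ha] at h1
  rw [key _ hb] at h2
  omega

theorem eval_ph_zero (A : Polynomial (Polynomial ℂ)) (φ : Polynomial ℂ) (hφ : φ.eval 0 = 0) :
    (A.eval φ).eval 0 = (A.coeff 0).eval 0 := by
  have h := Polynomial.sub_dvd_eval_sub φ 0 A
  obtain ⟨z, hz⟩ := h
  have := congrArg (fun P : Polynomial ℂ => P.eval 0) hz
  simp [hφ, ← Polynomial.coeff_zero_eq_eval_zero] at this
  rw [Polynomial.coeff_zero_eq_eval_zero]
  rw [Polynomial.coeff_zero_eq_eval_zero, Polynomial.coeff_zero_eq_eval_zero,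
    Polynomial.coeff_zero_eq_eval_zero] at this
  linear_combination this

theorem local_aux (A B : Polynomial (Polynomial ℂ)) (φ E E1 : Polynomial ℂ)
    (hE : E.eval 0 ≠ 0) (h0 : (A * B).eval φ = Polynomial.X ^ 9 * E)
    (h1 : (Polynomial.derivative (A * B)).eval φ = Polynomial.X ^ 5 * E1)
    (h2 : ((Polynomial.derivative (Polynomial.derivative (A * B))).eval φ).eval 0 ≠ 0)
    (hB : Polynomial.X ^ 5 ∣ B.eval φ) : (A.eval φ).eval 0 ≠ 0 := by
  have hE0 : E ≠ 0 := by
    rintro rfl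
    simp at hE
  rw [Polynomial.eval_mul] at h0
  have hne : A.eval φ * B.eval φ ≠ 0 := by
    rw [h0]
    exact mul_ne_zero (pow_ne_zero _ Polynomial.X_ne_zero) hE0
  have hA0 := left_ne_zero_of_mul hne
  have hnA : ¬ Polynomial.X ^ 5 ∣ A.eval φ := by
    intro hA
    have h10 : (Polynomial.X : Polynomial ℂ) ^ 9 * Polynomial.X ∣ Polynomial.X ^ 9 * E := by
      rw [← h0]
      have := mul_dvd_mul hA hB
      rw [← pow_add] at this
      rw [← pow_succ]
      exact this
    rw [mul_dvd_mul_iff_left (pow_ne_zero _ Polynomial.X_ne_zero), Polynomial.X_dvd_iff,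
      Polynomial.coeff_zero_eq_eval_zero] at h10
    exact hE h10
  have hB0 : (B.eval φ).eval 0 = 0 := by
    rw [← Polynomial.coeff_zero_eq_eval_zero, ← Polynomial.X_dvd_iff]
    exact (dvd_pow_self _ (by norm_num)).trans hB
  have hd : Polynomial.X ^ 5 ∣ A.eval φ * (Polynomial.derivative B).eval φ := by
    rw [Polynomial.derivative_mul, Polynomial.eval_add, Polynomial.eval_mul,
      Polynomial.eval_mul] at h1
    have : A.eval φ * (Polynomial.derivative B).eval φ
        = Polynomial.X ^ 5 * E1 - (Polynomial.derivative A).eval φ * B.eval φ := by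
      rw [← h1]; ring
    rw [this]
    exact dvd_sub (dvd_mul_right _ _) (Dvd.dvd.mul_left hB _)
  have hB1 : ((Polynomial.derivative B).eval φ).eval 0 = 0 := by
    rw [← Polynomial.coeff_zero_eq_eval_zero, ← Polynomial.X_dvd_iff]
    by_cases hz : (Polynomial.derivative B).eval φ = 0
    · rw [hz]; exact dvd_zero _
    · rcases prime_split (m := 4) (n := 0) hA0 hz hd with h | h
      · exact absurd h hnA
      · simpa using h
  intro hA
  apply h2
  simp [Polynomial.derivative_mul, hA, hB0, hB1]

theorem local_or (s : ℂ) (hs : s^2 - 59 = 0) (A B : Polynomial (Polynomial ℂ))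
    (h : A * B = Gam s) : (A.coeff 0).eval 0 ≠ 0 ∨ (B.coeff 0).eval 0 ≠ 0 := by
  obtain ⟨E, h0, hE⟩ := Gam_ph s hs
  obtain ⟨E1, h1⟩ := dGam_ph s hs
  have h2 := ddGam_ph s
  have hφ : (ph s).eval 0 = 0 := by simp [ph_eval]
  have hE0 : E ≠ 0 := by
    rintro rfl
    simp at hE
  have h0' := h0
  rw [← h, Polynomial.eval_mul] at h0'
  have hne : A.eval (ph s) * B.eval (ph s) ≠ 0 := by
    rw [h0']
    exact mul_ne_zero (pow_ne_zero _ Polynomial.X_ne_zero) hE0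
  rcases prime_split (m := 4) (n := 4) (left_ne_zero_of_mul hne) (right_ne_zero_of_mul hne)
    (by rw [h0']; exact dvd_mul_right _ _) with hA | hB
  · right
    rw [← eval_ph_zero B (ph s) hφ]
    rw [← h, mul_comm A B] at h0 h1 h2
    exact local_aux B A (ph s) E E1 hE h0 h1 h2 hA
  · left
    rw [← eval_ph_zero A (ph s) hφ]
    rw [← h] at h0 h1 h2
    exact local_aux A B (ph s) E E1 hE h0 h1 h2 hB

theorem ev_f2 (u t r : ℂ) (hr : r = ((Real.sqrt 59 : ℝ) : ℂ)) (hs : r^2 - 59 = 0) :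
    MvPolynomial.eval ![1 + 2*t + (29-2*r)/5*u, 1 + t] f2
    = 29/5*t^2+29/5*u+3231/25*u^2-2/5*r*t^2-2/5*r*u-348/25*r*u^2+1481/25*t*u-123/25*r*t*u := by
  simp [f2, x, y, c, s, ← hr]
  linear_combination (12/25*u^2+2/25*t*u)*hs

theorem ev_g2 (u t r : ℂ) (hr : r = ((Real.sqrt 59 : ℝ) : ℂ)) (hs : r^2 - 59 = 0) :
    MvPolynomial.eval ![1 + 2*t + (29-2*r)/5*u, 1 + t] g2
    = -7/5*t^2-7/5*u-1398/25*u^2+1/5*r*t^2+1/5*r*u+159/25*r*u^2-628/25*t*u+123/50*r*t*u := by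
  simp [g2, x, y, c, s, ← hr]
  linear_combination (-678/109505*t^2-1608/109505*u-147762/547525*u^2+36/109505*r*u+84/547525*r*u^2+72/547525*r^2*u^2
      -42802/547525*t*u+318/547525*r*t*u)*hs

theorem ev_h2 (u t r : ℂ) (hr : r = ((Real.sqrt 59 : ℝ) : ℂ)) (hs : r^2 - 59 = 0) :
    MvPolynomial.eval ![1 + 2*t + (29-2*r)/5*u, 1 + t] h2
    = -29079/14641-3132/14641*r-363960/14641*t-5629586/73205*t^2-36386/605*u-17079/25*u^2-31860/14641
      *r*t-219832/73205*r*t^2+428/605*r*u+1632/25*r*u^2-1215404/3025*t*u+51432/3025*r*t*u := by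
  simp [h2, x, y, c, s, ← hr]
  linear_combination (23268384/375292753+261150480/375292753*t+2920778112/1876463765*t^2+4144345872/1876463765*u+
      114965699364/9382318825*u^2-48627072/375292753*r*u-17194383408/9382318825*r*u^2+
      561301632/9382318825*r^2*u^2+18535255328/1876463765*t*u-5727286272/9382318825*r*t*u)*hs

theorem ev_g (u t r : ℂ) (hr : r = ((Real.sqrt 59 : ℝ) : ℂ)) (hs : r^2 - 59 = 0) :
    MvPolynomial.eval ![1 + 2*t + (29-2*r)/5*u, 1 + t] g = (-22140/14641+2754/14641*r) * Gx r u t := by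
  rw [g, MvPolynomial.eval_add, MvPolynomial.eval_mul, MvPolynomial.eval_pow, MvPolynomial.eval_pow,
    ev_f2 u t r hr hs, ev_g2 u t r hr hs, ev_h2 u t r hr hs, Gx]
  linear_combination (14769/366025*t^4+27432/73205*t^5+1380267/366025*t^6+14769/366025*u^2+15778287/1830125*u^3+
      1395081414/9150625*u^4+5051071791/9150625*u^5+6728362119/9150625*u^6-3132/366025*r*t^4-
      6372/73205*r*t^5-67392/366025*r*t^6-3132/366025*r*u^2-1061316/1830125*r*u^3-
      99958212/9150625*r*u^4-2861028/75625*r*u^5-35424/625*r*u^6+6459102/1830125*t*u^2+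
      1620074493/9150625*t*u^3+12950692452/9150625*t*u^4+15309803493/9150625*t*u^5+29538/366025
      *t^2*u+33993324/831875*t^2*u^2+729872721/831875*t^2*u^3+23867804493/9150625*t^2*u^4+
      7144902/1830125*t^3*u+353495016/1830125*t^3*u^2+14010014421/9150625*t^3*u^3+
      16253001/366025*t^4*u+5136926067/9150625*t^4*u^2+265708161/1830125*t^5*u-544536/1830125*r
      *t*u^2-120926844/9150625*r*t*u^3-1123357896/9150625*r*t*u^4-9798408/75625*r*t*u^5-
      6264/366025*r*t^2*u-38757987/9150625*r*t^2*u^2-824554323/9150625*r*t^2*u^3-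
      497252412/1830125*r*t^2*u^4-703836/1830125*r*t^3*u-4047327/166375*r*t^3*u^2-
      1528599033/9150625*r*t^3*u^3-931608/366025*r*t^4*u-386157132/9150625*r*t^4*u^2-
      8485236/1830125*r*t^5*u)*hs


def Phi (r : ℂ) : MvPolynomial (Fin 2) ℂ →+* Polynomial (Polynomial ℂ) :=
  MvPolynomial.eval₂Hom (Polynomial.C.comp Polynomial.C)
    ![1 + 2 * Polynomial.C Polynomial.X
        + Polynomial.C (Polynomial.C ((29-2*r)/5)) * Polynomial.X,
      1 + Polynomial.C Polynomial.X]

theorem Phi_eval (r u t : ℂ) (F : MvPolynomial (Fin 2) ℂ) :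
    ((Phi r F).eval (Polynomial.C u)).eval t
      = MvPolynomial.eval ![1 + 2*t + (29-2*r)/5*u, 1 + t] F := by
  have h : ((Polynomial.evalRingHom t).comp
      ((Polynomial.evalRingHom (Polynomial.C u)).comp (Phi r)))
      = MvPolynomial.eval ![1 + 2*t + (29-2*r)/5*u, 1 + t] := by
    apply MvPolynomial.ringHom_ext
    · intro a
      simp [Phi]
    · intro i
      fin_cases i <;> simp [Phi]
  exact congrArg (fun k => k F) h

theorem dbl_funext (P Q : Polynomial (Polynomial ℂ))
    (h : ∀ u t : ℂ, (P.eval (Polynomial.C u)).eval t = (Q.eval (Polynomial.C u)).eval t) :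
    P = Q := by
  have h1 : ∀ u : ℂ, P.eval (Polynomial.C u) = Q.eval (Polynomial.C u) :=
    fun u => Polynomial.funext (h u)
  apply Polynomial.eq_of_infinite_eval_eq
  apply Set.Infinite.mono (s := Set.range (Polynomial.C : ℂ → Polynomial ℂ))
  · rintro _ ⟨u, rfl⟩
    exact h1 u
  · exact Set.infinite_range_of_injective Polynomial.C_injective

theorem Phi_g (r : ℂ) (hr : r = ((Real.sqrt 59 : ℝ) : ℂ)) (hs : r^2 - 59 = 0) :
    Phi r g = Polynomial.C (Polynomial.C (-22140/14641+2754/14641*r)) * Gam r := by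
  apply dbl_funext
  intro u t
  rw [Phi_eval, ev_g u t r hr hs, Polynomial.eval_mul, Polynomial.eval_mul, Gam_eval]
  simp

def Wd (n : ℕ) (P : Polynomial (Polynomial ℂ)) : Prop :=
  ∀ i j, n < i + j → (P.coeff i).coeff j = 0

theorem Wd_mono {m n : ℕ} (h : m ≤ n) {P : Polynomial (Polynomial ℂ)} (hP : Wd m P) : Wd n P :=
  fun i j hij => hP i j (lt_of_le_of_lt h hij)

theorem Wd_add {n : ℕ} {P Q : Polynomial (Polynomial ℂ)} (hP : Wd n P) (hQ : Wd n Q) :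
    Wd n (P + Q) := by
  intro i j hij
  simp [hP i j hij, hQ i j hij]

theorem Wd_mul {m n : ℕ} {P Q : Polynomial (Polynomial ℂ)} (hP : Wd m P) (hQ : Wd n Q) :
    Wd (m + n) (P * Q) := by
  intro i j hij
  rw [Polynomial.coeff_mul, Polynomial.finset_sum_coeff]
  apply Finset.sum_eq_zero
  rintro ⟨a, b⟩ hab
  rw [Polynomial.coeff_mul]
  apply Finset.sum_eq_zero
  rintro ⟨k, l⟩ hkl
  rw [Finset.HasAntidiagonal.mem_antidiagonal] at hab hkl
  dsimp only at *
  by_cases h : m < a + k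
  · rw [hP a k h, zero_mul]
  · rw [hQ b l (by omega), mul_zero]

theorem Wd_const (a : ℂ) : Wd 0 (Polynomial.C (Polynomial.C a)) := by
  intro i j hij
  rw [Polynomial.coeff_C]
  split_ifs with h
  · rw [Polynomial.coeff_C, if_neg (by omega)]
  · simp

theorem Wd_t : Wd 1 (Polynomial.C Polynomial.X) := by
  intro i j hij
  rw [Polynomial.coeff_C]
  split_ifs with h
  · rw [Polynomial.coeff_X, if_neg (by omega)]
  · simp

theorem Wd_u : Wd 1 Polynomial.X := by
  intro i j hij
  rw [Polynomial.coeff_X]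
  split_ifs with h
  · rw [Polynomial.coeff_one, if_neg (by omega)]
  · simp

theorem Wd_pow {m : ℕ} {P : Polynomial (Polynomial ℂ)} (hP : Wd m P) (k : ℕ) :
    Wd (k * m) (P ^ k) := by
  induction k with
  | zero => simpa using Wd_const 1
  | succ k ih =>
    rw [pow_succ, Nat.succ_mul]
    exact Wd_mul ih hP

theorem Wd_sum {n : ℕ} {ι : Type*} (S : Finset ι) (f : ι → Polynomial (Polynomial ℂ))
    (h : ∀ i ∈ S, Wd n (f i)) : Wd n (∑ i ∈ S, f i) := by
  classical
  induction S using Finset.induction_on with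
  | empty => intro i j _; simp
  | insert a S ha ih =>
    rw [Finset.sum_insert ha]
    exact Wd_add (h a (Finset.mem_insert_self _ _))
      (ih (fun i hi => h i (Finset.mem_insert_of_mem hi)))

theorem Wd_Phi (r : ℂ) (n : ℕ) (F : MvPolynomial (Fin 2) ℂ) (hF : F.totalDegree ≤ n) :
    Wd n (Phi r F) := by
  have e1 : (1 : Polynomial (Polynomial ℂ)) = Polynomial.C (Polynomial.C 1) := by simp
  have e2 : (2 : Polynomial (Polynomial ℂ)) = Polynomial.C (Polynomial.C 2) := by
    rw [map_ofNat, map_ofNat]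
  have hx : Wd 1 (1 + 2 * Polynomial.C Polynomial.X
        + Polynomial.C (Polynomial.C ((29-2*r)/5)) * Polynomial.X) := by
    rw [e1, e2]
    exact Wd_add (Wd_add (Wd_mono (by norm_num) (Wd_const 1)) (Wd_mul (Wd_const 2) Wd_t))
      (Wd_mul (Wd_const _) Wd_u)
  have hy : Wd 1 (1 + Polynomial.C Polynomial.X) := by
    rw [e1]
    exact Wd_add (Wd_mono (by norm_num) (Wd_const 1)) Wd_t
  rw [Phi, MvPolynomial.coe_eval₂Hom, MvPolynomial.eval₂_eq']
  apply Wd_sum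
  intro d hd
  have hdeg := MvPolynomial.le_totalDegree hd
  rw [Finsupp.sum_fintype _ _ (fun _ => rfl), Fin.sum_univ_two] at hdeg
  rw [Fin.prod_univ_two]
  have := Wd_mul (Wd_const (MvPolynomial.coeff d F)) (Wd_mul (Wd_pow hx (d 0)) (Wd_pow hy (d 1)))
  refine Wd_mono ?_ this
  omega

theorem Wd_expand (n : ℕ) (P : Polynomial (Polynomial ℂ)) (h : Wd n P) (u t : ℂ) :
    (P.eval (Polynomial.C u)).eval t
      = ∑ i ∈ Finset.range (n+1), ∑ j ∈ Finset.range (n+1-i), (P.coeff i).coeff j * u^i * t^j := by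
  have h1 : P.natDegree < n + 1 := by
    rw [Nat.lt_succ_iff, Polynomial.natDegree_le_iff_coeff_eq_zero]
    intro N hN
    ext j
    simpa using h N j (by omega)
  rw [Polynomial.eval_eq_sum_range' h1, Polynomial.eval_finset_sum]
  apply Finset.sum_congr rfl
  intro i hi
  rw [Finset.mem_range] at hi
  have h2 : (P.coeff i).natDegree < n + 1 - i := by
    have : (P.coeff i).natDegree ≤ n - i := by
      rw [Polynomial.natDegree_le_iff_coeff_eq_zero]
      intro N hN
      exact h i N (by omega)
    omega
  rw [Polynomial.eval_mul, Polynomial.eval_pow, Polynomial.eval_C,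
    Polynomial.eval_eq_sum_range' h2, Finset.sum_mul]
  apply Finset.sum_congr rfl
  intro j _
  ring

theorem Phi_expand (r : ℂ) (n : ℕ) (F : MvPolynomial (Fin 2) ℂ) (hF : F.totalDegree ≤ n)
    (u t : ℂ) : MvPolynomial.eval ![1 + 2*t + (29-2*r)/5*u, 1 + t] F
      = ∑ i ∈ Finset.range (n+1), ∑ j ∈ Finset.range (n+1-i),
        ((Phi r F).coeff i).coeff j * u^i * t^j := by
  rw [← Phi_eval, Wd_expand n _ (Wd_Phi r n F hF)]

theorem deg_f2 : f2.totalDegree ≤ 2 ∧ g2.totalDegree ≤ 2 ∧ h2.totalDegree ≤ 2 := by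
  have hx : x.totalDegree ≤ 1 := by simp [x]
  have hy : y.totalDegree ≤ 1 := by simp [y]
  have hc : ∀ q, (c q).totalDegree ≤ 0 := fun q => by simp [c]
  have hs : s.totalDegree ≤ 0 := by simp [s]
  have hn : ∀ (n : ℕ) [n.AtLeastTwo],
      (OfNat.ofNat n : MvPolynomial (Fin 2) ℂ).totalDegree ≤ 0 := by
    intro n _
    have : (OfNat.ofNat n : MvPolynomial (Fin 2) ℂ) = MvPolynomial.C (OfNat.ofNat n) := by
      rw [map_ofNat]
    rw [this]; simp
  have ha : ∀ {p q : MvPolynomial (Fin 2) ℂ} {n : ℕ}, p.totalDegree ≤ n → q.totalDegree ≤ n →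
      (p + q).totalDegree ≤ n := fun h1 h2 =>
    (MvPolynomial.totalDegree_add _ _).trans (max_le h1 h2)
  have hb : ∀ {p q : MvPolynomial (Fin 2) ℂ} {n : ℕ}, p.totalDegree ≤ n → q.totalDegree ≤ n →
      (p - q).totalDegree ≤ n := fun h1 h2 =>
    (MvPolynomial.totalDegree_sub _ _).trans (max_le h1 h2)
  have hm : ∀ {p q : MvPolynomial (Fin 2) ℂ} {m n k : ℕ}, p.totalDegree ≤ m → q.totalDegree ≤ n →
      m + n = k → (p * q).totalDegree ≤ k := fun h1 h2 h3 =>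
    h3 ▸ (MvPolynomial.totalDegree_mul _ _).trans (add_le_add h1 h2)
  have up : ∀ {p : MvPolynomial (Fin 2) ℂ} {m n : ℕ}, p.totalDegree ≤ m → m ≤ n →
      p.totalDegree ≤ n := fun h1 h2 => h1.trans h2
  have x1 := up hx one_le_two
  have y1 := up hy one_le_two
  have x2 : (x^2).totalDegree ≤ 2 := by rw [sq]; exact hm hx hx rfl
  have y2 : (y^2).totalDegree ≤ 2 := by rw [sq]; exact hm hy hy rfl
  have s2 := up hs zero_le_two
  have kx : ∀ {p : MvPolynomial (Fin 2) ℂ}, p.totalDegree ≤ 0 → (p * x).totalDegree ≤ 1 :=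
    fun h => hm h hx rfl
  have ky : ∀ {p : MvPolynomial (Fin 2) ℂ}, p.totalDegree ≤ 0 → (p * y).totalDegree ≤ 1 :=
    fun h => hm h hy rfl
  have kxx : ∀ {p : MvPolynomial (Fin 2) ℂ}, p.totalDegree ≤ 0 → (p * x^2).totalDegree ≤ 2 :=
    fun h => hm h x2 rfl
  have kyy : ∀ {p : MvPolynomial (Fin 2) ℂ}, p.totalDegree ≤ 0 → (p * y^2).totalDegree ≤ 2 :=
    fun h => hm h y2 rfl
  have kxy : ∀ {p : MvPolynomial (Fin 2) ℂ}, p.totalDegree ≤ 0 → (p * x * y).totalDegree ≤ 2 :=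
    fun h => hm (kx h) hy rfl
  have ks : ∀ {p : MvPolynomial (Fin 2) ℂ} {n : ℕ}, p.totalDegree ≤ n → (p * s).totalDegree ≤ n :=
    fun h => hm h hs rfl
  have cc : ∀ q, (c q).totalDegree ≤ 2 := fun q => up (hc q) zero_le_two
  have nn : ∀ (n : ℕ) [n.AtLeastTwo],
      (OfNat.ofNat n : MvPolynomial (Fin 2) ℂ).totalDegree ≤ 2 := fun n _ => up (hn n) zero_le_two
  have ox : ∀ {p : MvPolynomial (Fin 2) ℂ}, p.totalDegree ≤ 1 → p.totalDegree ≤ 2 :=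
    fun h => up h one_le_two
  have ox2 : ∀ {p : MvPolynomial (Fin 2) ℂ}, p.totalDegree ≤ 0 → (p * x).totalDegree ≤ 2 :=
    fun h => ox (kx h)
  have oy2 : ∀ {p : MvPolynomial (Fin 2) ℂ}, p.totalDegree ≤ 0 → (p * y).totalDegree ≤ 2 :=
    fun h => ox (ky h)
  refine ⟨?_, ?_, ?_⟩
  · rw [f2]
    exact ha (hb (hb (ha (ha (ha (ha (hb (hb (by rw [MvPolynomial.totalDegree_neg]; exact y2)
      (ks (kxy (hc _)))) (kxy (hc _))) (ks (ox (ky (hc _))))) (ox (ky (hc _)))) (kxx (hn 3)))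
      (ks (ox (kx (hc _))))) (ox (kx (hc _)))) (ks (cc _))) (cc _)
  · rw [g2, MvPolynomial.totalDegree_neg]
    refine hm (m := 0) (n := 2) (hm (m := 0) (n := 0) (hc _) (ha ?_ (ks (hn _))) rfl) ?_ rfl
    · rw [MvPolynomial.totalDegree_neg]; exact hn _
    · repeat' first
        | with_reducible apply ha | with_reducible apply hb | with_reducible apply ks
        | with_reducible apply kxy | with_reducible apply kxx | with_reducible apply kyy
        | with_reducible apply ox2 | with_reducible apply oy2
        | with_reducible exact nn _ | with_reducible exact hn _
  · rw [h2]
    refine hm (m := 0) (n := 2) (hm (m := 0) (n := 0) (hc _) (ha ?_ (ks (hn _))) rfl) ?_ rfl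
    · rw [MvPolynomial.totalDegree_neg]; exact hn _
    · repeat' first
        | with_reducible apply ha | with_reducible apply hb | with_reducible apply ks
        | with_reducible apply kxy | with_reducible apply kxx | with_reducible apply kyy
        | with_reducible apply ox2 | with_reducible apply oy2
        | with_reducible exact nn _ | with_reducible exact hn _

theorem deg_g : g.totalDegree ≤ 6 := by
  obtain ⟨h1, h2, h3⟩ := deg_f2
  rw [g]
  refine (MvPolynomial.totalDegree_add _ _).trans (max_le ?_ ?_)
  · exact (MvPolynomial.totalDegree_pow _ _).trans (by omega)
  · refine (MvPolynomial.totalDegree_mul _ _).trans ?_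
    have := MvPolynomial.totalDegree_pow g2 2
    omega

theorem Cne (r : ℂ) (hs : r^2 - 59 = 0) : (-6584/25-281/50*r : ℂ) ≠ 0 := by
  intro h
  have : (1:ℂ) = 0 := by
    linear_combination (-26336/6749501+562/6749501*r)*h + (78961/168737525)*hs
  exact one_ne_zero this

theorem Qne (r : ℂ) (hs : r^2 - 59 = 0) : (-22140/14641+2754/14641*r : ℂ) ≠ 0 := by
  intro h
  have : (1:ℂ) = 0 := by
    linear_combination (-205/27-17/18*r)*h + (2601/14641)*hs
  exact one_ne_zero this

theorem inner_case (r : ℂ) (hs : r^2 - 59 = 0)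
    (p10 p11 p20 p02 q03 q10 q11 q12 q20 q21 q30 : ℂ) (hp : p02 ≠ 0)
    (h : ∀ u t : ℂ, Gx r u t = (p02*t^2 + p10*u + p11*u*t + p20*u^2)^3
      + (t^2 + q03*t^3 + q10*u + q11*u*t + q12*u*t^2 + q20*u^2 + q21*u^2*t + q30*u^3)^2) :
    False := by
  refine no_inner r hs (p02^3) (p10/p02) (p11/p02) (p20/p02) q03 q10 q11 q12 q20 q21 q30 ?_
  intro u t
  rw [h u t, ← mul_pow]
  field_simp

theorem torus (r : ℂ) (hs : r^2 - 59 = 0)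
    (p00 p01 p02 p10 p11 p20 q00 q01 q02 q03 q10 q11 q12 q20 q21 q30 : ℂ)
    (h : ∀ u t : ℂ, Gx r u t = (p00 + p01*t + p02*t^2 + p10*u + p11*u*t + p20*u^2)^3
      + (q00 + q01*t + q02*t^2 + q03*t^3 + q10*u + q11*u*t + q12*u*t^2 + q20*u^2 + q21*u^2*t
        + q30*u^3)^2) :
    False := by
  obtain ⟨e0, e1, e2, e3, e4, e5, e6⟩ := coeffs7 (p00^3+q00^2) (3*p00^2*p01+2*q00*q01)
    (3*p00^2*p02+3*p00*p01^2+q01^2+2*q00*q02) (p01^3+6*p00*p01*p02+2*q00*q03+2*q01*q02)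
    (3*p00*p02^2+3*p01^2*p02+q02^2+2*q01*q03-1) (3*p01*p02^2+2*q02*q03-(88/5-4/5*r))
    (p02^3+q03^2-(-4412/25-633/50*r)) (fun t => by
      have := h 0 t
      rw [Gx] at this
      linear_combination -this)
  by_cases hp : p00 = 0
  · subst hp
    have hq0 : q00 = 0 := by
      have : q00^2 = 0 := by linear_combination e0
      exact pow_eq_zero_iff (two_ne_zero) |>.mp this
    subst hq0
    have hq1 : q01 = 0 := by
      have : q01^2 = 0 := by linear_combination e2
      exact pow_eq_zero_iff (two_ne_zero) |>.mp this
    subst hq1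
    have hp1 : p01 = 0 := by
      have : p01^3 = 0 := by linear_combination e3
      exact pow_eq_zero_iff (three_ne_zero) |>.mp this
    subst hp1
    have hq2 : (q02 - 1) * (q02 + 1) = 0 := by linear_combination e4
    have hp2 : p02 ≠ 0 := by
      rintro rfl
      apply Cne r hs
      linear_combination (-1:ℂ)*e6 - (q03^2)*e4 + (q02*q03/2 + (88/5-4/5*r)/4) * e5 + 4/25*hs
    rcases mul_eq_zero.mp hq2 with h1 | h1
    · obtain rfl : q02 = 1 := by linear_combination h1
      exact inner_case r hs p10 p11 p20 p02 q03 q10 q11 q12 q20 q21 q30 hp2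
        (fun u t => by rw [h u t]; ring)
    · obtain rfl : q02 = -1 := by linear_combination h1
      exact inner_case r hs p10 p11 p20 p02 (-q03) (-q10) (-q11) (-q12) (-q20) (-q21) (-q30) hp2
        (fun u t => by rw [h u t]; ring)
  · have hq : q00 ≠ 0 := by
      rintro rfl
      apply hp
      have : p00^3 = 0 := by linear_combination e0
      exact pow_eq_zero_iff (three_ne_zero) |>.mp this
    obtain ⟨v, hv⟩ : ∃ v, v = -q00/p00 := ⟨_, rfl⟩
    have hv1 : v * p00 = -q00 := by rw [hv]; field_simp
    have hv0 : v ≠ 0 := by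
      rintro rfl
      apply hq
      linear_combination hv1
    have hpv : p00 = -v^2 := by
      have : p00^2 * (p00 + v^2) = 0 := by linear_combination e0 + (v*p00 - q00)*hv1
      rcases mul_eq_zero.mp this with h1 | h1
      · exact absurd (pow_eq_zero_iff (two_ne_zero) |>.mp h1) hp
      · linear_combination h1
    have hqv : q00 = v^3 := by
      linear_combination hv1 - v*hpv
    subst hpv
    subst hqv
    refine no_outer r hs (v^6) (-p01/v^2) (-p02/v^2) (-p10/v^2) (-p11/v^2) (-p20/v^2)
      (q01/v^3) (q02/v^3) (q03/v^3) (q10/v^3) (q11/v^3) (q12/v^3) (q20/v^3) (q21/v^3) (q30/v^3) ?_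
    intro u t
    rw [h u t]
    field_simp
    ring

theorem non_torus (r : ℂ) (hr : r = ((Real.sqrt 59 : ℝ) : ℂ)) (hs : r^2 - 59 = 0)
    (p q : MvPolynomial (Fin 2) ℂ) (hp : p.totalDegree ≤ 2) (hq : q.totalDegree ≤ 3)
    (h : g = p^3 + q^2) : False := by
  obtain ⟨z, hz⟩ := IsAlgClosed.exists_pow_nat_eq (-22140/14641+2754/14641*r : ℂ) (n := 6)
    (by norm_num)
  have hQ := Qne r hs
  have hz0 : z ≠ 0 := by
    rintro rfl
    apply hQ
    rw [← hz]
    norm_num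
  obtain ⟨a, ha⟩ : ∃ a : ℕ → ℕ → ℂ, a = fun i j => ((Phi r p).coeff i).coeff j := ⟨_, rfl⟩
  obtain ⟨b, hb⟩ : ∃ b : ℕ → ℕ → ℂ, b = fun i j => ((Phi r q).coeff i).coeff j := ⟨_, rfl⟩
  refine torus r hs (a 0 0/z^2) (a 0 1/z^2) (a 0 2/z^2) (a 1 0/z^2) (a 1 1/z^2) (a 2 0/z^2)
    (b 0 0/z^3) (b 0 1/z^3) (b 0 2/z^3) (b 0 3/z^3) (b 1 0/z^3) (b 1 1/z^3) (b 1 2/z^3)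
    (b 2 0/z^3) (b 2 1/z^3) (b 3 0/z^3) ?_
  intro u t
  have h1 := ev_g u t r hr hs
  rw [h, MvPolynomial.eval_add, MvPolynomial.eval_pow, MvPolynomial.eval_pow,
    Phi_expand r 2 p hp, Phi_expand r 3 q hq, ← hz] at h1
  have ha' : ∀ i j, ((Phi r p).coeff i).coeff j = a i j := fun i j => by rw [ha]
  have hb' : ∀ i j, ((Phi r q).coeff i).coeff j = b i j := fun i j => by rw [hb]
  simp only [ha', hb', Finset.sum_range_succ, Finset.sum_range_zero, Nat.reduceAdd, Nat.reduceSub,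
    Nat.sub_zero, zero_add, pow_zero, mul_one, pow_one] at h1
  have hz6 : z^6 ≠ 0 := pow_ne_zero _ hz0
  apply mul_left_cancel₀ hz6
  rw [← h1]
  field_simp
  ring

theorem Gam_coeff0 (r : ℂ) : (Gam r).coeff 0 = Polynomial.X^4 *
    (1 + Polynomial.C (88/5-4/5*r) * Polynomial.X + Polynomial.C (-4412/25-633/50*r) * Polynomial.X^2) := by
  rw [Polynomial.coeff_zero_eq_eval_zero]
  simp [Gam]
  ring

theorem Hne (r : ℂ) (hs : r^2 - 59 = 0) : (-4412/25-633/50*r : ℂ) ≠ 0 := by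
  intro h
  have : (1:ℂ) = 0 := by
    linear_combination (-17648/2168893+1266/2168893*r)*h + (400689/54222325)*hs
  exact one_ne_zero this

theorem factor_unit (r : ℂ) (hr : r = ((Real.sqrt 59 : ℝ) : ℂ)) (hs : r^2 - 59 = 0)
    (a b : MvPolynomial (Fin 2) ℂ) (hab : g = a * b)
    (ha0 : ((Phi r a).coeff 0).eval 0 ≠ 0) : IsUnit a := by
  have hQ := Qne r hs
  have hPhi := Phi_g r hr hs
  rw [hab, map_mul] at hPhi
  have h0 : (Phi r a).coeff 0 * (Phi r b).coeff 0 = Polynomial.X^4 *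
      (Polynomial.C (-22140/14641+2754/14641*r) *
      (1 + Polynomial.C (88/5-4/5*r) * Polynomial.X + Polynomial.C (-4412/25-633/50*r) * Polynomial.X^2)) := by
    have := congrArg (fun P : Polynomial (Polynomial ℂ) => P.coeff 0) hPhi
    simp only [Polynomial.mul_coeff_zero, Polynomial.coeff_C_zero, Gam_coeff0] at this
    rw [this]; ring
  have hdeg : ((Phi r a).coeff 0 * (Phi r b).coeff 0).natDegree = 6 := by
    rw [h0]
    have hH := mul_ne_zero hQ (Hne r hs)
    have : (Polynomial.X^4 *
      (Polynomial.C (-22140/14641+2754/14641*r) *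
      (1 + Polynomial.C (88/5-4/5*r) * Polynomial.X + Polynomial.C (-4412/25-633/50*r) * Polynomial.X^2))
      : Polynomial ℂ) = Polynomial.C ((-22140/14641+2754/14641*r)*(-4412/25-633/50*r)) * Polynomial.X^6
      + Polynomial.C ((-22140/14641+2754/14641*r)*(88/5-4/5*r)) * Polynomial.X^5
      + Polynomial.C (-22140/14641+2754/14641*r) * Polynomial.X^4 := by
      simp only [map_mul]; ring
    rw [this]
    compute_degree!
    refine ⟨fun h => hQ ?_, fun h => Hne r hs ?_⟩
    · linear_combination h
    · linear_combination h
  have hne : (Phi r a).coeff 0 * (Phi r b).coeff 0 ≠ 0 := by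
    intro h; rw [h] at hdeg; simp at hdeg
  have hA := left_ne_zero_of_mul hne
  have hB := right_ne_zero_of_mul hne
  rw [Polynomial.natDegree_mul hA hB] at hdeg
  have hX : ¬ Polynomial.X ∣ (Phi r a).coeff 0 := by
    rw [Polynomial.X_dvd_iff, Polynomial.coeff_zero_eq_eval_zero]
    exact ha0
  have h4 : Polynomial.X^4 ∣ (Phi r b).coeff 0 :=
    Polynomial.prime_X.pow_dvd_of_dvd_mul_left 4 hX (by rw [h0]; exact dvd_mul_right _ _)
  have h4' := Polynomial.natDegree_le_of_dvd h4 hB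
  rw [Polynomial.natDegree_X_pow] at h4'
  have hg0 : g ≠ 0 := by
    intro h
    rw [← map_mul, ← hab, h, map_zero] at hPhi
    apply hne
    rw [h0, ← mul_assoc, mul_comm (Polynomial.X^4), mul_assoc, ← Gam_coeff0]
    have := congrArg (fun P : Polynomial (Polynomial ℂ) => P.coeff 0) hPhi
    simp only [Polynomial.mul_coeff_zero, Polynomial.coeff_C_zero, Polynomial.coeff_zero] at this
    exact this.symm
  have ha : a ≠ 0 := by rintro rfl; apply hg0; rw [hab, zero_mul]
  have hb : b ≠ 0 := by rintro rfl; apply hg0; rw [hab, mul_zero]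
  have htd : a.totalDegree + b.totalDegree ≤ 6 := by
    rw [← MvPolynomial.totalDegree_mul_of_isDomain ha hb, ← hab]
    exact deg_g
  have dle : ∀ F : MvPolynomial (Fin 2) ℂ, ((Phi r F).coeff 0).natDegree ≤ F.totalDegree := by
    intro F
    rw [Polynomial.natDegree_le_iff_coeff_eq_zero]
    intro N hN
    exact Wd_Phi r _ F le_rfl 0 N (by omega)
  have d1 := dle a
  have d2 := dle b
  have hcases : a.totalDegree = 0 ∨ (a.totalDegree = 1 ∧ b.totalDegree ≤ 5) ∨
      (a.totalDegree = 2 ∧ b.totalDegree ≤ 4) := by omega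
  obtain ⟨A, hAd⟩ : ∃ A : ℕ → ℕ → ℂ, A = fun i j => ((Phi r a).coeff i).coeff j := ⟨_, rfl⟩
  obtain ⟨B, hBd⟩ : ∃ B : ℕ → ℕ → ℂ, B = fun i j => ((Phi r b).coeff i).coeff j := ⟨_, rfl⟩
  have hA' : ∀ i j, ((Phi r a).coeff i).coeff j = A i j := fun i j => by rw [hAd]
  have hB' : ∀ i j, ((Phi r b).coeff i).coeff j = B i j := fun i j => by rw [hBd]
  rw [← Polynomial.coeff_zero_eq_eval_zero, hA'] at ha0
  obtain ⟨Q0, hQ0⟩ : ∃ Q0, Q0 = (-22140/14641+2754/14641*r : ℂ) := ⟨_, rfl⟩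
  rw [← hQ0] at hQ
  rcases hcases with hd | ⟨hd, hd2⟩ | ⟨hd, hd2⟩
  · rw [MvPolynomial.totalDegree_eq_zero_iff_eq_C] at hd
    rw [hd]
    apply IsUnit.map
    rw [isUnit_iff_ne_zero]
    intro h
    rw [h, map_zero] at hd
    exact ha hd
  · exfalso
    refine no_line r hs (A 0 1/A 0 0) (A 1 0/A 0 0) (A 0 0*B 0 0/Q0) (A 0 0*B 0 1/Q0) (A 0 0*B 0 2/Q0) (A 0 0*B 0 3/Q0) (A 0 0*B 0 4/Q0)
      (A 0 0*B 0 5/Q0) (A 0 0*B 1 0/Q0) (A 0 0*B 1 1/Q0) (A 0 0*B 1 2/Q0) (A 0 0*B 1 3/Q0)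
      (A 0 0*B 1 4/Q0) (A 0 0*B 2 0/Q0) (A 0 0*B 2 1/Q0) (A 0 0*B 2 2/Q0) (A 0 0*B 2 3/Q0)
      (A 0 0*B 3 0/Q0) (A 0 0*B 3 1/Q0) (A 0 0*B 3 2/Q0) (A 0 0*B 4 0/Q0) (A 0 0*B 4 1/Q0)
      (A 0 0*B 5 0/Q0) ?_
    intro u t
    have h1 := ev_g u t r hr hs
    rw [hab, MvPolynomial.eval_mul, Phi_expand r 1 a hd.le, Phi_expand r 5 b hd2, ← hQ0] at h1
    simp only [hA', hB', Finset.sum_range_succ, Finset.sum_range_zero, Nat.reduceAdd, Nat.reduceSub,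
      Nat.sub_zero, zero_add, pow_zero, mul_one, pow_one] at h1
    apply mul_left_cancel₀ hQ
    rw [← h1]
    field_simp
    ring
  · exfalso
    refine no_conic r hs (A 0 1/A 0 0) (A 0 2/A 0 0) (A 1 0/A 0 0) (A 1 1/A 0 0) (A 2 0/A 0 0)
      (A 0 0*B 0 0/Q0) (A 0 0*B 0 1/Q0) (A 0 0*B 0 2/Q0) (A 0 0*B 0 3/Q0) (A 0 0*B 0 4/Q0)
      (A 0 0*B 1 0/Q0) (A 0 0*B 1 1/Q0) (A 0 0*B 1 2/Q0) (A 0 0*B 1 3/Q0) (A 0 0*B 2 0/Q0)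
      (A 0 0*B 2 1/Q0) (A 0 0*B 2 2/Q0) (A 0 0*B 3 0/Q0) (A 0 0*B 3 1/Q0) (A 0 0*B 4 0/Q0) ?_
    intro u t
    have h1 := ev_g u t r hr hs
    rw [hab, MvPolynomial.eval_mul, Phi_expand r 2 a hd.le, Phi_expand r 4 b hd2, ← hQ0] at h1
    simp only [hA', hB', Finset.sum_range_succ, Finset.sum_range_zero, Nat.reduceAdd, Nat.reduceSub,
      Nat.sub_zero, zero_add, pow_zero, mul_one, pow_one] at h1
    apply mul_left_cancel₀ hQ
    rw [← h1]
    field_simp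
    ring

theorem g_irr (r : ℂ) (hr : r = ((Real.sqrt 59 : ℝ) : ℂ)) (hs : r^2 - 59 = 0) :
    Irreducible g := by
  have hQ := Qne r hs
  constructor
  · intro hu
    have h := hu.map (MvPolynomial.eval ![1 + 2*0 + (29-2*r)/5*0, 1 + 0])
    rw [ev_g 0 0 r hr hs] at h
    simp [Gx] at h
  · intro a b hab
    have hPhi := Phi_g r hr hs
    rw [hab, map_mul] at hPhi
    have hl := local_or r hs (Phi r a)
      (Phi r b * Polynomial.C (Polynomial.C (-22140/14641+2754/14641*r)⁻¹)) (by
        rw [← mul_assoc, hPhi, mul_comm, ← mul_assoc, ← map_mul, ← map_mul, inv_mul_cancel₀ hQ]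
        simp)
    rcases hl with h | h
    · left
      exact factor_unit r hr hs a b hab h
    · right
      apply factor_unit r hr hs b a (by rw [hab, mul_comm])
      intro h0
      apply h
      rw [Polynomial.mul_coeff_zero, Polynomial.eval_mul, h0, zero_mul]

theorem g_irreducible_and_non_torus :
    Irreducible g ∧
      ¬ ∃ p q : MvPolynomial (Fin 2) ℂ,
        p.totalDegree ≤ 2 ∧ q.totalDegree ≤ 3 ∧ g = p ^ 3 + q ^ 2 := by
  have hs : (((Real.sqrt 59 : ℝ) : ℂ))^2 - 59 = 0 := by
    rw [← Complex.ofReal_pow, Real.sq_sqrt (by norm_num)]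
    norm_num
  refine ⟨g_irr _ rfl hs, ?_⟩
  rintro ⟨p, q, hp, hq, h⟩
  exact non_torus _ rfl hs p q hp hq h

end
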